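/- Let T > 0, ν > 0. Let ω : ℝ² × [0,T] → ℝ be smooth and bounded with bounded spatial gradient, and let u = ū + u' where ū, u' : ℝ² × [0,T] → ℝ² are smooth, ū has bounded spatial derivatives and u' is bounded. Let φ₁, φ₂ : ℝ² × [0,T] → ℝ be smooth, with φ₁(·,t) and φ₂(·,t) supported in a fixed compact subset of ℝ² for all t, satisfying −∂ₜφ₁ − u·∇φ₁ − φ₂ − νΔφ₁ = 0 and −Δφ₂ = rot φ₁ · ∇ω pointwise, with φ₁(·,T) = ξ₀. Define J := sup_{t∈[0,T]} ( sup_{x∈ℝ²} √((∂₁ū₁ − ∂₂ū₂)² + (∂₂ū₁ + ∂₁ū₂)²)(x,t) + ν⁻¹ sup_{x∈ℝ²} |u'(x,t)|² ). Then ∫₀^T ‖∇φ₂(·,t)‖_{L²(ℝ²)} dt ≤ e^{JT} ( ∫₀^T ‖ω(·,t)‖_{L^∞(ℝ²)} dt ) ‖∇ξ₀‖_{L²(ℝ²)}. -/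

import Mathlib

open MeasureTheory Matrix Set

noncomputable section

/-- The plane `ℝ²` with the Euclidean structure. -/
abbrev E2 := EuclideanSpace ℝ (Fin 2)

/-- Partial derivative `∂ᵢ f` of a scalar function on `ℝ²`. -/
def pd (i : Fin 2) (f : E2 → ℝ) (x : E2) : ℝ :=
  fderiv ℝ f x (EuclideanSpace.single i 1)

/-- The Laplacian `Δ f = ∂₁∂₁ f + ∂₂∂₂ f`. -/
def lap (f : E2 → ℝ) (x : E2) : ℝ :=
  pd 0 (pd 0 f) x + pd 1 (pd 1 f) x

/-- The rotated gradient `rot ψ = (∂₂ψ, −∂₁ψ)`. -/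
def rotv (f : E2 → ℝ) (x : E2) : Fin 2 → ℝ := ![pd 1 f x, -(pd 0 f x)]

/-- The gradient `∇f = (∂₁f, ∂₂f)` as a plain vector. -/
def grad2 (f : E2 → ℝ) (x : E2) : Fin 2 → ℝ := ![pd 0 f x, pd 1 f x]

/-- The Jacobian matrix `(∇u)ᵢⱼ = ∂ⱼ uᵢ` of a vector field. -/
def gradMat (u : E2 → Fin 2 → ℝ) (x : E2) : Matrix (Fin 2) (Fin 2) ℝ :=
  Matrix.of fun i j => pd j (fun y => u y i) x

/-- The divergence `∇·u = ∂₁u₁ + ∂₂u₂` of a vector field. -/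
def divg (u : E2 → Fin 2 → ℝ) (x : E2) : ℝ :=
  pd 0 (fun y => u y 0) x + pd 1 (fun y => u y 1) x

section PartialDerivatives

variable {f g : E2 → ℝ}

theorem pd_add (i : Fin 2) (x : E2) (hf : Differentiable ℝ f) (hg : Differentiable ℝ g) :
    pd i (fun y => f y + g y) x = pd i f x + pd i g x := by
  simp only [pd]
  rw [fderiv_fun_add hf.differentiableAt hg.differentiableAt]
  rfl

theorem pd_sub (i : Fin 2) (x : E2) (hf : Differentiable ℝ f) (hg : Differentiable ℝ g) :
    pd i (fun y => f y - g y) x = pd i f x - pd i g x := by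
  simp only [pd]
  rw [fderiv_fun_sub hf.differentiableAt hg.differentiableAt]
  rfl

theorem pd_mul (i : Fin 2) (x : E2) (hf : Differentiable ℝ f) (hg : Differentiable ℝ g) :
    pd i (fun y => f y * g y) x = f x * pd i g x + g x * pd i f x := by
  simp only [pd]
  rw [fderiv_fun_mul hf.differentiableAt hg.differentiableAt]
  rfl

theorem pd_const (i : Fin 2) (x : E2) (c : ℝ) : pd i (fun _ => c) x = 0 := by
  simp [pd]

theorem contDiff_pd (i : Fin 2) (hf : ContDiff ℝ (⊤ : ℕ∞) f) :
    ContDiff ℝ (⊤ : ℕ∞) (pd i f) :=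
  (hf.fderiv_right (m := (⊤ : ℕ∞)) (by simp)).clm_apply contDiff_const

theorem fderiv_fderiv_apply_comm {V : Type*} [NormedAddCommGroup V] [NormedSpace ℝ V]
    {F : V → ℝ} (hF : ContDiff ℝ (⊤ : ℕ∞) F) (p v w : V) :
    fderiv ℝ (fun q => fderiv ℝ F q v) p w = fderiv ℝ (fun q => fderiv ℝ F q w) p v := by
  have hd : DifferentiableAt ℝ (fderiv ℝ F) p :=
    ((hF.fderiv_right (m := (⊤ : ℕ∞)) (by simp)).differentiable (by simp)).differentiableAt
  have hsymm : IsSymmSndFDerivAt ℝ F p :=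
    hF.contDiffAt.isSymmSndFDerivAt (by
      rw [minSmoothness_of_isRCLikeNormedField]
      exact WithTop.coe_le_coe.2 le_top)
  rw [fderiv_clm_apply hd (differentiableAt_const v),
    fderiv_clm_apply hd (differentiableAt_const w)]
  simpa using hsymm w v

theorem pd_comm (hf : ContDiff ℝ (⊤ : ℕ∞) f) (i j : Fin 2) (x : E2) :
    pd i (pd j f) x = pd j (pd i f) x :=
  fderiv_fderiv_apply_comm hf x _ _

theorem pd_eq_zero_of_notMem_tsupport (i : Fin 2) {x : E2} (hx : x ∉ tsupport f) :
    pd i f x = 0 := by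
  have : fderiv ℝ f x = 0 := by
    by_contra h
    exact hx (support_fderiv_subset ℝ h)
  simp [pd, this]

theorem integral_pd_eq_zero (i : Fin 2) (hf : ContDiff ℝ (⊤ : ℕ∞) f) (hc : HasCompactSupport f) :
    ∫ x, pd i f x = 0 := by
  have hi : Integrable (pd i f) :=
    (contDiff_pd i hf).continuous.integrable_of_hasCompactSupport
      (hc.fderiv_apply (𝕜 := ℝ) (EuclideanSpace.single i 1))
  have := integral_mul_fderiv_eq_neg_fderiv_mul_of_integrable (μ := (volume : Measure E2))
    (f := fun _ => (1 : ℝ)) (g := f) (v := EuclideanSpace.single i 1) (by simp)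
    (by simp only [one_mul]; exact hi) (by simpa using hf.continuous.integrable_of_hasCompactSupport hc)
    (fun x _ => differentiableAt_const _) (fun x _ => (hf.differentiable (by simp)).differentiableAt)
  simpa [pd] using this

/-- A smooth compactly supported vector field has an integrable divergence of integral zero. -/
theorem integral_div_eq_zero (hf : ContDiff ℝ (⊤ : ℕ∞) f) (hg : ContDiff ℝ (⊤ : ℕ∞) g)
    (hfc : HasCompactSupport f) (hgc : HasCompactSupport g) :
    Integrable (fun x => pd 0 f x + pd 1 g x) ∧ ∫ x, (pd 0 f x + pd 1 g x) = 0 := by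
  have h0 : Integrable (pd 0 f) :=
    (contDiff_pd 0 hf).continuous.integrable_of_hasCompactSupport
      (hfc.fderiv_apply (𝕜 := ℝ) (EuclideanSpace.single 0 1))
  have h1 : Integrable (pd 1 g) :=
    (contDiff_pd 1 hg).continuous.integrable_of_hasCompactSupport
      (hgc.fderiv_apply (𝕜 := ℝ) (EuclideanSpace.single 1 1))
  refine ⟨h0.add h1, ?_⟩
  rw [integral_add h0 h1, integral_pd_eq_zero 0 hf hfc, integral_pd_eq_zero 1 hg hgc, add_zero]

theorem integrable_sq_add_sq_pd (hf : ContDiff ℝ (⊤ : ℕ∞) f) (hc : HasCompactSupport f) :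
    Integrable (fun x => pd 0 f x ^ 2 + pd 1 f x ^ 2) := by
  have h0 := (contDiff_pd 0 hf).continuous
  have h1 := (contDiff_pd 1 hf).continuous
  refine Continuous.integrable_of_hasCompactSupport (by fun_prop) (.intro hc fun x hx => ?_)
  simp [pd_eq_zero_of_notMem_tsupport _ hx]

end PartialDerivatives

theorem sq_le_sq_of_abs_le {a C : ℝ} (h : |a| ≤ C) : a ^ 2 ≤ C ^ 2 :=
  sq_le_sq' (by linarith [neg_abs_le a]) ((le_abs_self a).trans h)

theorem trace_free_form_le (α β p q : ℝ) :
    α * (p ^ 2 - q ^ 2) + β * (2 * p * q) ≤ √(α ^ 2 + β ^ 2) * (p ^ 2 + q ^ 2) := by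
  refine (Real.le_sqrt_of_sq_le (y := (α ^ 2 + β ^ 2) * (p ^ 2 + q ^ 2) ^ 2) ?_).trans ?_
  · nlinarith [sq_nonneg (α * (2 * p * q) - β * (p ^ 2 - q ^ 2))]
  · rw [Real.sqrt_mul (by positivity), Real.sqrt_sq (by positivity)]

theorem quadratic_lower_bound {ν J S B : ℝ} (hν : 0 < ν) (hJ : S + ν⁻¹ * B ≤ J)
    {g00 g01 g10 g11 b0 b1 : ℝ} (hS : √((g00 - g11) ^ 2 + (g01 + g10) ^ 2) ≤ S)
    (hB : b0 ^ 2 + b1 ^ 2 ≤ B) (p q L : ℝ) :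
    0 ≤ -((g00 * p ^ 2 + (g01 + g10) * p * q + g11 * q ^ 2)
        - (g00 + g11) * (p ^ 2 + q ^ 2) / 2)
      + L * (b0 * p + b1 * q) + ν * L ^ 2 + J / 2 * (p ^ 2 + q ^ 2) := by
  have h1 := trace_free_form_le (g00 - g11) (g01 + g10) p q
  have hn : 0 ≤ p ^ 2 + q ^ 2 := by positivity
  have hB0 : 0 ≤ B := le_trans (by positivity) hB
  have h2 := mul_le_mul_of_nonneg_right hS hn
  have h3 := mul_le_mul_of_nonneg_right hJ hn
  have h4 : 0 ≤ ν⁻¹ * B * (p ^ 2 + q ^ 2) / 2 + L * (b0 * p + b1 * q) + ν * L ^ 2 := by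
    have hcs : (b0 * p + b1 * q) ^ 2 ≤ B * (p ^ 2 + q ^ 2) := by
      nlinarith [sq_nonneg (b0 * q - b1 * p), mul_le_mul_of_nonneg_right hB hn]
    have hcs' := mul_le_mul_of_nonneg_left hcs (inv_pos.2 hν).le
    have hsq : 0 ≤ ν⁻¹ * (2 * ν * L + (b0 * p + b1 * q)) ^ 2 := by positivity
    have he : ν⁻¹ * (2 * ν * L + (b0 * p + b1 * q)) ^ 2 = 4 * (ν * L ^ 2)
        + 4 * (L * (b0 * p + b1 * q)) + ν⁻¹ * (b0 * p + b1 * q) ^ 2 := by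
      field_simp
      ring
    have hpos : 0 ≤ ν⁻¹ * (b0 * p + b1 * q) ^ 2 := by positivity
    linarith
  nlinarith

/-- The energy inequality for the gradient of `φ` at a fixed time, where `D` stands for `∂ₜφ`. -/
theorem energy_lower_bound {ν J S B : ℝ} (hν : 0 < ν) (hJ : S + ν⁻¹ * B ≤ J)
    {φ ψ ω D a0 a1 b0 b1 : E2 → ℝ}
    (hφ : ContDiff ℝ (⊤ : ℕ∞) φ) (hψ : ContDiff ℝ (⊤ : ℕ∞) ψ) (hω : ContDiff ℝ (⊤ : ℕ∞) ω)
    (hD : ContDiff ℝ (⊤ : ℕ∞) D)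
    (ha0 : ContDiff ℝ (⊤ : ℕ∞) a0) (ha1 : ContDiff ℝ (⊤ : ℕ∞) a1)
    (hc : HasCompactSupport φ)
    (hS : ∀ x, √((pd 0 a0 x - pd 1 a1 x) ^ 2 + (pd 1 a0 x + pd 0 a1 x) ^ 2) ≤ S)
    (hB : ∀ x, b0 x ^ 2 + b1 x ^ 2 ≤ B)
    (heq1 : ∀ x, D x = -((a0 x + b0 x) * pd 0 φ x + (a1 x + b1 x) * pd 1 φ x)
      - ψ x - ν * lap φ x)
    (heq2 : ∀ x, lap ψ x = -(pd 1 φ x * pd 0 ω x - pd 0 φ x * pd 1 ω x)) :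
    -(J / 2) * ∫ x, (pd 0 φ x ^ 2 + pd 1 φ x ^ 2)
      ≤ ∫ x, (pd 0 φ x * pd 0 D x + pd 1 φ x * pd 1 D x) := by
  have hp0 := contDiff_pd 0 hφ
  have hp1 := contDiff_pd 1 hφ
  have hq0 := contDiff_pd 0 hψ
  have hq1 := contDiff_pd 1 hψ
  have hw0 := contDiff_pd 0 hω
  have hw1 := contDiff_pd 1 hω
  have hD0 := contDiff_pd 0 hD
  have hD1 := contDiff_pd 1 hD
  let V0 : E2 → ℝ := fun x => D x * pd 0 φ x + (a0 x * pd 0 φ x + a1 x * pd 1 φ x) * pd 0 φ x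
    - 1 / 2 * (a0 x * (pd 0 φ x * pd 0 φ x + pd 1 φ x * pd 1 φ x)) + ψ x * pd 0 φ x
    - φ x * pd 0 ψ x + 1 / 2 * (φ x * φ x * pd 1 ω x)
  let V1 : E2 → ℝ := fun x => D x * pd 1 φ x + (a0 x * pd 0 φ x + a1 x * pd 1 φ x) * pd 1 φ x
    - 1 / 2 * (a1 x * (pd 0 φ x * pd 0 φ x + pd 1 φ x * pd 1 φ x)) + ψ x * pd 1 φ x
    - φ x * pd 1 ψ x - 1 / 2 * (φ x * φ x * pd 0 ω x)
  have hV0 : ContDiff ℝ (⊤ : ℕ∞) V0 := by fun_prop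
  have hV1 : ContDiff ℝ (⊤ : ℕ∞) V1 := by fun_prop
  have hc0 : HasCompactSupport V0 := .intro hc fun x hx => by
    simp [V0, pd_eq_zero_of_notMem_tsupport _ hx, image_eq_zero_of_notMem_tsupport hx]
  have hc1 : HasCompactSupport V1 := .intro hc fun x hx => by
    simp [V1, pd_eq_zero_of_notMem_tsupport _ hx, image_eq_zero_of_notMem_tsupport hx]
  obtain ⟨hdi, hd0⟩ := integral_div_eq_zero hV0 hV1 hc0 hc1
  have hgi := integrable_sq_add_sq_pd hφ hc
  have hri : Integrable fun x => pd 0 φ x * pd 0 D x + pd 1 φ x * pd 1 D x := by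
    refine Continuous.integrable_of_hasCompactSupport
      (by have := hp0.continuous; have := hp1.continuous; have := hD0.continuous
          have := hD1.continuous; fun_prop) (.intro hc fun x hx => ?_)
    simp [pd_eq_zero_of_notMem_tsupport _ hx]
  have key : ∀ x, (pd 0 V0 x + pd 1 V1 x) + -(J / 2) * (pd 0 φ x ^ 2 + pd 1 φ x ^ 2)
      ≤ pd 0 φ x * pd 0 D x + pd 1 φ x * pd 1 D x := by
    intro x
    have dφ := hφ.differentiable (by simp)
    have dψ := hψ.differentiable (by simp)
    have dD := hD.differentiable (by simp)
    have da0 := ha0.differentiable (by simp)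
    have da1 := ha1.differentiable (by simp)
    have dp0 := hp0.differentiable (by simp)
    have dp1 := hp1.differentiable (by simp)
    have dq0 := hq0.differentiable (by simp)
    have dq1 := hq1.differentiable (by simp)
    have dw0 := hw0.differentiable (by simp)
    have dw1 := hw1.differentiable (by simp)
    have hQ := quadratic_lower_bound hν hJ (hS x) (hB x) (pd 0 φ x) (pd 1 φ x) (lap φ x)
    have e1 := heq1 x
    have e2 := heq2 x
    have c1 := pd_comm hφ 0 1 x
    have c2 := pd_comm hω 0 1 x
    have hdiv : pd 0 V0 x + pd 1 V1 x
        = pd 0 φ x * pd 0 D x + pd 1 φ x * pd 1 D x + D x * lap φ x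
          + (a0 x * pd 0 φ x + a1 x * pd 1 φ x) * lap φ x
          + ((pd 0 a0 x * pd 0 φ x ^ 2 + (pd 1 a0 x + pd 0 a1 x) * pd 0 φ x * pd 1 φ x
            + pd 1 a1 x * pd 1 φ x ^ 2)
            - (pd 0 a0 x + pd 1 a1 x) * (pd 0 φ x ^ 2 + pd 1 φ x ^ 2) / 2)
          + ψ x * lap φ x - φ x * lap ψ x
          - φ x * (pd 1 φ x * pd 0 ω x - pd 0 φ x * pd 1 ω x) := by
      simp (disch := fun_prop) only [V0, V1, pd_add, pd_sub, pd_mul, pd_const, lap]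
      rw [c1, c2]
      ring
    rw [hdiv, e2]
    have e3 : D x * lap φ x = (-((a0 x + b0 x) * pd 0 φ x + (a1 x + b1 x) * pd 1 φ x)
      - ψ x - ν * lap φ x) * lap φ x := by rw [← e1]
    linarith
  have := integral_mono (hdi.add (hgi.const_mul (-(J / 2)))) hri key
  simp only [Pi.add_apply] at this
  rwa [integral_add hdi (hgi.const_mul _), hd0, zero_add, integral_const_mul] at this

/-- The elliptic estimate `‖∇ψ‖ ≤ ‖ω‖_∞ ‖∇φ‖` for `-Δψ = rot φ · ∇ω`. -/
theorem integral_sq_grad_le {M : ℝ} {φ ψ ω : E2 → ℝ}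
    (hφ : ContDiff ℝ (⊤ : ℕ∞) φ) (hψ : ContDiff ℝ (⊤ : ℕ∞) ψ) (hω : ContDiff ℝ (⊤ : ℕ∞) ω)
    (hcφ : HasCompactSupport φ) (hcψ : HasCompactSupport ψ) (hM : ∀ x, |ω x| ≤ M)
    (heq : ∀ x, lap ψ x = -(pd 1 φ x * pd 0 ω x - pd 0 φ x * pd 1 ω x)) :
    ∫ x, (pd 0 ψ x ^ 2 + pd 1 ψ x ^ 2) ≤ M ^ 2 * ∫ x, (pd 0 φ x ^ 2 + pd 1 φ x ^ 2) := by
  have hp0 := contDiff_pd 0 hφ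
  have hp1 := contDiff_pd 1 hφ
  have hq0 := contDiff_pd 0 hψ
  have hq1 := contDiff_pd 1 hψ
  let V0 : E2 → ℝ := fun x => ψ x * pd 0 ψ x + ψ x * ω x * pd 1 φ x
  let V1 : E2 → ℝ := fun x => ψ x * pd 1 ψ x - ψ x * ω x * pd 0 φ x
  have hV0 : ContDiff ℝ (⊤ : ℕ∞) V0 := by fun_prop
  have hV1 : ContDiff ℝ (⊤ : ℕ∞) V1 := by fun_prop
  have hc0 : HasCompactSupport V0 := .intro hcψ fun x hx => by
    simp [V0, image_eq_zero_of_notMem_tsupport hx]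
  have hc1 : HasCompactSupport V1 := .intro hcψ fun x hx => by
    simp [V1, image_eq_zero_of_notMem_tsupport hx]
  obtain ⟨hdi, hd0⟩ := integral_div_eq_zero hV0 hV1 hc0 hc1
  have hgφ := integrable_sq_add_sq_pd hφ hcφ
  have hgψ := integrable_sq_add_sq_pd hψ hcψ
  have key : ∀ x, pd 0 ψ x ^ 2 + pd 1 ψ x ^ 2
      ≤ 2 * (pd 0 V0 x + pd 1 V1 x) + M ^ 2 * (pd 0 φ x ^ 2 + pd 1 φ x ^ 2) := by
    intro x
    have dψ := hψ.differentiable (by simp)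
    have dω := hω.differentiable (by simp)
    have dp0 := hp0.differentiable (by simp)
    have dp1 := hp1.differentiable (by simp)
    have dq0 := hq0.differentiable (by simp)
    have dq1 := hq1.differentiable (by simp)
    have c1 := pd_comm hφ 0 1 x
    have hdiv : pd 0 V0 x + pd 1 V1 x = pd 0 ψ x ^ 2 + pd 1 ψ x ^ 2 + ψ x * lap ψ x
        + ψ x * (pd 1 φ x * pd 0 ω x - pd 0 φ x * pd 1 ω x)
        + ω x * (pd 1 φ x * pd 0 ψ x - pd 0 φ x * pd 1 ψ x) := by
      simp (disch := fun_prop) only [V0, V1, pd_add, pd_sub, pd_mul, lap]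
      rw [c1]
      ring
    rw [hdiv, heq x]
    have hω2 : ω x ^ 2 ≤ M ^ 2 := sq_le_sq_of_abs_le (hM x)
    have := mul_le_mul_of_nonneg_right hω2
      (show 0 ≤ pd 0 φ x ^ 2 + pd 1 φ x ^ 2 by positivity)
    nlinarith [sq_nonneg (pd 0 ψ x + ω x * pd 1 φ x), sq_nonneg (pd 1 ψ x - ω x * pd 0 φ x)]
  have := integral_mono hgψ ((hdi.const_mul 2).add (hgφ.const_mul (M ^ 2))) key
  simp only [Pi.add_apply] at this
  rwa [integral_add (hdi.const_mul 2) (hgφ.const_mul _), integral_const_mul, hd0, mul_zero,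
    zero_add, integral_const_mul] at this

/-- Differentiation under the integral sign over a compact set. -/
theorem hasDerivAt_setIntegral_of_contDiff {G : ℝ × E2 → ℝ} (hG : ContDiff ℝ (⊤ : ℕ∞) G)
    {K : Set E2} (hK : IsCompact K) (t : ℝ) :
    HasDerivAt (fun s => ∫ x in K, G (s, x)) (∫ x in K, fderiv ℝ G (t, x) (1, 0)) t := by
  have hG' : Continuous fun p => fderiv ℝ G p (1, 0) :=
    (hG.continuous_fderiv (by simp)).clm_apply continuous_const
  have hGc := hG.continuous
  obtain ⟨C, hC⟩ := ((isCompact_closedBall t 1).prod hK).exists_bound_of_continuousOn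
    hG'.continuousOn
  have : IsFiniteMeasure (volume.restrict K) := ⟨by simpa using hK.measure_lt_top⟩
  refine (hasDerivAt_integral_of_dominated_loc_of_deriv_le (bound := fun _ => C)
    (F' := fun s x => fderiv ℝ G (s, x) (1, 0))
    (Metric.closedBall_mem_nhds t one_pos) (.of_forall fun s => ?_) ?_ ?_ ?_
    (integrable_const C) (.of_forall fun x s _ => ?_)).2
  · exact Continuous.aestronglyMeasurable (by fun_prop)
  · exact ContinuousOn.integrableOn_compact hK (Continuous.continuousOn (by fun_prop))
  · exact (hG'.comp (by fun_prop : Continuous fun x : E2 => (t, x))).aestronglyMeasurable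
  · filter_upwards [ae_restrict_mem hK.measurableSet] with x hx s hs
    exact hC (s, x) ⟨hs, hx⟩
  · exact ((hG.differentiable (by simp)).differentiableAt.hasFDerivAt).comp_hasDerivAt s
      ((hasDerivAt_id s).prodMk (hasDerivAt_const s x))

theorem pd_slice {F : ℝ × E2 → ℝ} (hF : ContDiff ℝ (⊤ : ℕ∞) F) (i : Fin 2) (t : ℝ) (x : E2) :
    pd i (fun y => F (t, y)) x = fderiv ℝ F (t, x) (0, EuclideanSpace.single i 1) := by
  have h := ((hF.differentiable (by simp)).differentiableAt.hasFDerivAt (x := (t, x))).comp x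
    ((hasFDerivAt_const t x).prodMk (hasFDerivAt_id x))
  have : fderiv ℝ (fun y => F (t, y)) x = _ := h.fderiv
  simp [pd, this]

theorem deriv_slice {F : ℝ × E2 → ℝ} (hF : ContDiff ℝ (⊤ : ℕ∞) F) (t : ℝ) (x : E2) :
    deriv (fun s => F (s, x)) t = fderiv ℝ F (t, x) (1, 0) :=
  (((hF.differentiable (by simp)).differentiableAt.hasFDerivAt (x := (t, x))).comp_hasDerivAt t
      ((hasDerivAt_id t).prodMk (hasDerivAt_const t x))).deriv

/-- The squared `L²` norm over `K` of the gradient is differentiable in time. -/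
theorem hasDerivAt_setIntegral_sq_grad {φ : ℝ → E2 → ℝ}
    (hφ : ContDiff ℝ (⊤ : ℕ∞) (fun p : ℝ × E2 => φ p.1 p.2)) {K : Set E2} (hK : IsCompact K)
    (t : ℝ) :
    HasDerivAt (fun s => ∫ x in K, (pd 0 (φ s) x ^ 2 + pd 1 (φ s) x ^ 2))
      (2 * ∫ x in K, (pd 0 (φ t) x * pd 0 (fun y => deriv (fun s => φ s y) t) x
        + pd 1 (φ t) x * pd 1 (fun y => deriv (fun s => φ s y) t) x)) t := by
  set F : ℝ × E2 → ℝ := fun p => φ p.1 p.2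
  have hdF (v : ℝ × E2) : ContDiff ℝ (⊤ : ℕ∞) fun p => fderiv ℝ F p v :=
    (hφ.fderiv_right (m := (⊤ : ℕ∞)) (by simp)).clm_apply contDiff_const
  have hP (i : Fin 2) (s : ℝ) (x : E2) :
      pd i (φ s) x = fderiv ℝ F (s, x) (0, EuclideanSpace.single i 1) := pd_slice hφ i s x
  have hDt (y : E2) : deriv (fun s => φ s y) t = fderiv ℝ F (t, y) (1, 0) := deriv_slice hφ t y
  have hPD (i : Fin 2) (x : E2) : pd i (fun y => deriv (fun s => φ s y) t) x
      = fderiv ℝ (fun p => fderiv ℝ F p (0, EuclideanSpace.single i 1)) (t, x) (1, 0) := by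
    simp only [hDt]
    rw [pd_slice (hdF (1, 0)), fderiv_fderiv_apply_comm hφ]
  have h0 := hdF (0, EuclideanSpace.single 0 1)
  have h1 := hdF (0, EuclideanSpace.single 1 1)
  have h := hasDerivAt_setIntegral_of_contDiff (G := fun p =>
    fderiv ℝ F p (0, EuclideanSpace.single 0 1) ^ 2
      + fderiv ℝ F p (0, EuclideanSpace.single 1 1) ^ 2) ((h0.pow 2).add (h1.pow 2)) hK t
  simp only [hP, hPD]
  convert h using 1
  rw [← integral_const_mul]
  congr 1 with x
  have d0 := (h0.differentiable (by simp)).differentiableAt (x := (t, x))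
  have d1 := (h1.differentiable (by simp)).differentiableAt (x := (t, x))
  rw [fderiv_fun_add (d0.fun_pow 2) (d1.fun_pow 2), fderiv_fun_pow 2 d0, fderiv_fun_pow 2 d1]
  simp
  ring

/-- Backward Grönwall inequality. -/
theorem backward_gronwall {T J : ℝ} (hT : 0 ≤ T) {Y Y' : ℝ → ℝ}
    (hY : ∀ t, HasDerivAt Y (Y' t) t) (hle : ∀ t ∈ Icc 0 T, -J * Y t ≤ Y' t)
    {t : ℝ} (ht : t ∈ Icc 0 T) : Y t ≤ Real.exp (J * (T - t)) * Y T := by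
  have hd (s : ℝ) : HasDerivAt (fun s => Real.exp (J * s) * Y s)
      (Real.exp (J * s) * J * Y s + Real.exp (J * s) * Y' s) s := by
    have h1 : HasDerivAt (fun s => Real.exp (J * s)) (Real.exp (J * s) * J) s := by
      simpa using ((hasDerivAt_id s).const_mul J).exp
    exact h1.mul (hY s)
  have hm : MonotoneOn (fun s => Real.exp (J * s) * Y s) (Icc 0 T) := by
    refine monotoneOn_of_deriv_nonneg (convex_Icc 0 T)
      (fun s _ => (hd s).continuousAt.continuousWithinAt)
      (fun s _ => (hd s).differentiableAt.differentiableWithinAt) fun s hs => ?_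
    rw [(hd s).deriv]
    have := hle s (interior_subset hs)
    nlinarith [Real.exp_pos (J * s)]
  have h := hm ht (right_mem_Icc.2 hT) ht.2
  have he : Real.exp (J * (T - t)) = Real.exp (J * T) / Real.exp (J * t) := by
    rw [← Real.exp_sub]
    ring_nf
  rw [he, div_mul_eq_mul_div, le_div_iff₀ (Real.exp_pos _)]
  linarith

theorem intervalIntegrable_iSup_abs {ω : ℝ → E2 → ℝ}
    (hω : Continuous fun p : ℝ × E2 => ω p.1 p.2) {C : ℝ} (hC : ∀ t x, |ω t x| ≤ C) (a b : ℝ) :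
    IntervalIntegrable (fun t => ⨆ x, |ω t x|) volume a b := by
  have hm : Measurable fun t => ⨆ x, |ω t x| := by
    refine (lowerSemicontinuous_ciSup (fun t => ⟨C, ?_⟩) fun x => ?_).measurable
    · rintro _ ⟨x, rfl⟩
      exact hC t x
    · exact (hω.comp (by fun_prop : Continuous fun t : ℝ => (t, x))).abs.lowerSemicontinuous
  refine (intervalIntegrable_const (c := C)).mono_fun hm.aestronglyMeasurable
    (.of_forall fun t => ?_)
  simp only [Real.norm_eq_abs]
  rw [abs_of_nonneg (Real.iSup_nonneg fun x => abs_nonneg _)]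
  exact (ciSup_le fun x => hC t x).trans (le_abs_self C)

/-- stability estimate for the second dual variable `φ₂`:
`∫₀ᵀ ‖∇φ₂(·,t)‖ dt ≤ e^{JT} (∫₀ᵀ ‖ω(·,t)‖_{L^∞} dt) ‖∇ξ₀‖`. -/
theorem dual_stability_phi2 (T ν : ℝ) (hT : 0 < T) (hν : 0 < ν)
    (ω : ℝ → E2 → ℝ)
    (hω : ContDiff ℝ (⊤ : ℕ∞) (fun p : ℝ × E2 => ω p.1 p.2))
    (hωb : ∃ C, ∀ (t : ℝ) (x : E2), |ω t x| ≤ C)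
    (hωg : ∃ C, ∀ (t : ℝ) (x : E2) (i : Fin 2), |pd i (ω t) x| ≤ C)
    (ubar u' : ℝ → E2 → Fin 2 → ℝ)
    (hubar : ContDiff ℝ (⊤ : ℕ∞) (fun p : ℝ × E2 => ubar p.1 p.2))
    (hu' : ContDiff ℝ (⊤ : ℕ∞) (fun p : ℝ × E2 => u' p.1 p.2))
    (hubarD : ∃ C, ∀ (t : ℝ) (x : E2) (i j : Fin 2), |gradMat (ubar t) x i j| ≤ C)
    (hu'b : ∃ C, ∀ (t : ℝ) (x : E2) (i : Fin 2), |u' t x i| ≤ C)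
    (u : ℝ → E2 → Fin 2 → ℝ) (hu : ∀ t x, u t x = ubar t x + u' t x)
    (φ₁ φ₂ : ℝ → E2 → ℝ)
    (hφ₁ : ContDiff ℝ (⊤ : ℕ∞) (fun p : ℝ × E2 => φ₁ p.1 p.2))
    (hφ₂ : ContDiff ℝ (⊤ : ℕ∞) (fun p : ℝ × E2 => φ₂ p.1 p.2))
    (hsupp : ∃ K : Set E2, IsCompact K ∧
      ∀ t ∈ Set.Icc (0 : ℝ) T, tsupport (φ₁ t) ⊆ K ∧ tsupport (φ₂ t) ⊆ K)
    (heq1 : ∀ t ∈ Set.Icc (0 : ℝ) T, ∀ x : E2,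
      -(deriv (fun s => φ₁ s x) t) - (∑ i, u t x i * pd i (φ₁ t) x)
        - φ₂ t x - ν * lap (φ₁ t) x = 0)
    (heq2 : ∀ t ∈ Set.Icc (0 : ℝ) T, ∀ x : E2,
      -(lap (φ₂ t) x) = rotv (φ₁ t) x ⬝ᵥ grad2 (ω t) x)
    (ξ₀ : E2 → ℝ) (hξ : ∀ x : E2, φ₁ T x = ξ₀ x)
    (J : ℝ)
    (hJ : J = ⨆ t : Set.Icc (0 : ℝ) T,
      ((⨆ x : E2, Real.sqrt
          ((gradMat (ubar (t : ℝ)) x 0 0 - gradMat (ubar (t : ℝ)) x 1 1) ^ 2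
            + (gradMat (ubar (t : ℝ)) x 0 1 + gradMat (ubar (t : ℝ)) x 1 0) ^ 2))
        + ν⁻¹ * ⨆ x : E2, ((u' (t : ℝ) x 0) ^ 2 + (u' (t : ℝ) x 1) ^ 2))) :
    (∫ t in (0 : ℝ)..T, Real.sqrt (∫ x : E2, ((pd 0 (φ₂ t) x) ^ 2 + (pd 1 (φ₂ t) x) ^ 2)))
      ≤ Real.exp (J * T) * (∫ t in (0 : ℝ)..T, ⨆ x : E2, |ω t x|)
        * Real.sqrt (∫ x : E2, ((pd 0 ξ₀ x) ^ 2 + (pd 1 ξ₀ x) ^ 2)) := by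
  obtain ⟨Cω, hCω⟩ := hωb
  obtain ⟨C, hC⟩ := hubarD
  obtain ⟨C', hC'⟩ := hu'b
  obtain ⟨K, hK, hKs⟩ := hsupp
  have hslice {F : ℝ → E2 → ℝ} (hF : ContDiff ℝ (⊤ : ℕ∞) fun p : ℝ × E2 => F p.1 p.2) (t : ℝ) :
      ContDiff ℝ (⊤ : ℕ∞) (F t) := hF.comp (contDiff_const.prodMk contDiff_id)
  have hubari (t : ℝ) (i : Fin 2) : ContDiff ℝ (⊤ : ℕ∞) fun x => ubar t x i :=
    hslice (F := fun t x => ubar t x i) (contDiff_pi.1 hubar i) t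
  have hS (t : ℝ) (x : E2) : √((gradMat (ubar t) x 0 0 - gradMat (ubar t) x 1 1) ^ 2
      + (gradMat (ubar t) x 0 1 + gradMat (ubar t) x 1 0) ^ 2)
      ≤ √((C + C) ^ 2 + (C + C) ^ 2) :=
    Real.sqrt_le_sqrt (add_le_add
      (sq_le_sq_of_abs_le ((abs_sub _ _).trans (add_le_add (hC t x 0 0) (hC t x 1 1))))
      (sq_le_sq_of_abs_le ((abs_add_le _ _).trans (add_le_add (hC t x 0 1) (hC t x 1 0)))))
  have hB (t : ℝ) (x : E2) : u' t x 0 ^ 2 + u' t x 1 ^ 2 ≤ C' ^ 2 + C' ^ 2 :=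
    add_le_add (sq_le_sq_of_abs_le (hC' t x 0)) (sq_le_sq_of_abs_le (hC' t x 1))
  have hSJ (t : ℝ) (ht : t ∈ Icc 0 T) :
      (⨆ x : E2, √((gradMat (ubar t) x 0 0 - gradMat (ubar t) x 1 1) ^ 2
          + (gradMat (ubar t) x 0 1 + gradMat (ubar t) x 1 0) ^ 2))
        + ν⁻¹ * ⨆ x : E2, (u' t x 0 ^ 2 + u' t x 1 ^ 2) ≤ J := by
    rw [hJ]
    refine le_ciSup (f := fun t : Icc (0 : ℝ) T =>
      (⨆ x : E2, √((gradMat (ubar (t : ℝ)) x 0 0 - gradMat (ubar (t : ℝ)) x 1 1) ^ 2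
          + (gradMat (ubar (t : ℝ)) x 0 1 + gradMat (ubar (t : ℝ)) x 1 0) ^ 2))
        + ν⁻¹ * ⨆ x : E2, (u' (t : ℝ) x 0 ^ 2 + u' (t : ℝ) x 1 ^ 2))
      ⟨√((C + C) ^ 2 + (C + C) ^ 2) + ν⁻¹ * (C' ^ 2 + C' ^ 2), ?_⟩ ⟨t, ht⟩
    rintro _ ⟨s, rfl⟩
    exact add_le_add (ciSup_le (hS s))
      (mul_le_mul_of_nonneg_left (ciSup_le (hB s)) (inv_pos.2 hν).le)
  have hJ0 : 0 ≤ J := le_trans (add_nonneg (Real.iSup_nonneg fun _ => Real.sqrt_nonneg _)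
    (mul_nonneg (inv_pos.2 hν).le (Real.iSup_nonneg fun _ => by positivity)))
    (hSJ 0 (left_mem_Icc.2 hT.le))
  have hc₁ (t : ℝ) (ht : t ∈ Icc 0 T) : HasCompactSupport (φ₁ t) :=
    hK.of_isClosed_subset (isClosed_tsupport _) (hKs t ht).1
  have hc₂ (t : ℝ) (ht : t ∈ Icc 0 T) : HasCompactSupport (φ₂ t) :=
    hK.of_isClosed_subset (isClosed_tsupport _) (hKs t ht).2
  have hpd₁ (i : Fin 2) (t : ℝ) (ht : t ∈ Icc 0 T) (x : E2) (hx : x ∉ K) :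
      pd i (φ₁ t) x = 0 := pd_eq_zero_of_notMem_tsupport i fun h => hx ((hKs t ht).1 h)
  have heq2' (t : ℝ) (ht : t ∈ Icc 0 T) (x : E2) : lap (φ₂ t) x
      = -(pd 1 (φ₁ t) x * pd 0 (ω t) x - pd 0 (φ₁ t) x * pd 1 (ω t) x) := by
    have := heq2 t ht x
    simp only [rotv, grad2, dotProduct, Fin.sum_univ_two, Matrix.cons_val_zero,
      Matrix.cons_val_one] at this
    linarith
  have hY (t : ℝ) (ht : t ∈ Icc 0 T) : ∫ x in K, (pd 0 (φ₁ t) x ^ 2 + pd 1 (φ₁ t) x ^ 2)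
      = ∫ x, (pd 0 (φ₁ t) x ^ 2 + pd 1 (φ₁ t) x ^ 2) :=
    setIntegral_eq_integral_of_forall_compl_eq_zero fun x hx => by simp [hpd₁ _ t ht x hx]
  have hgr (t : ℝ) (ht : t ∈ Icc 0 T) : ∫ x, (pd 0 (φ₁ t) x ^ 2 + pd 1 (φ₁ t) x ^ 2)
      ≤ Real.exp (J * (T - t)) * ∫ x, (pd 0 ξ₀ x ^ 2 + pd 1 ξ₀ x ^ 2) := by
    rw [← funext hξ, ← hY t ht, ← hY T (right_mem_Icc.2 hT.le)]
    refine backward_gronwall hT.le (hasDerivAt_setIntegral_sq_grad hφ₁ hK) (fun s hs => ?_) ht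
    rw [hY s hs, setIntegral_eq_integral_of_forall_compl_eq_zero
      fun x hx => by simp [hpd₁ _ s hs x hx]]
    have hDs : ContDiff ℝ (⊤ : ℕ∞) fun x => deriv (fun r => φ₁ r x) s := by
      have hF : ContDiff ℝ (⊤ : ℕ∞) fun p => fderiv ℝ (fun p : ℝ × E2 => φ₁ p.1 p.2) p (1, 0) :=
        (hφ₁.fderiv_right (m := (⊤ : ℕ∞)) (by simp)).clm_apply contDiff_const
      rw [show (fun x => deriv (fun r => φ₁ r x) s) =
        fun x => fderiv ℝ (fun p : ℝ × E2 => φ₁ p.1 p.2) (s, x) (1, 0) from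
          funext fun x => deriv_slice hφ₁ s x]
      exact hF.comp (contDiff_const.prodMk contDiff_id)
    have := energy_lower_bound hν (hSJ s hs) (hslice hφ₁ s) (hslice hφ₂ s) (hslice hω s) hDs
      (hubari s 0) (hubari s 1) (b0 := fun x => u' s x 0) (b1 := fun x => u' s x 1) (hc₁ s hs)
      (fun x => le_ciSup (f := fun x =>
        √((gradMat (ubar s) x 0 0 - gradMat (ubar s) x 1 1) ^ 2
          + (gradMat (ubar s) x 0 1 + gradMat (ubar s) x 1 0) ^ 2))
        ⟨_, forall_mem_range.2 (hS s)⟩ x)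
      (fun x => le_ciSup (f := fun x => u' s x 0 ^ 2 + u' s x 1 ^ 2)
        ⟨_, forall_mem_range.2 (hB s)⟩ x)
      (fun x => by
        have := heq1 s hs x
        simp only [Fin.sum_univ_two, hu, Pi.add_apply] at this
        linarith)
      (heq2' s hs)
    linarith
  have hpt (t : ℝ) (ht : t ∈ Icc 0 T) : √(∫ x, (pd 0 (φ₂ t) x ^ 2 + pd 1 (φ₂ t) x ^ 2))
      ≤ Real.exp (J * T) * (⨆ x, |ω t x|) * √(∫ x, (pd 0 ξ₀ x ^ 2 + pd 1 ξ₀ x ^ 2)) := by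
    have hM0 : 0 ≤ ⨆ x, |ω t x| := Real.iSup_nonneg fun _ => abs_nonneg _
    have hI0 : 0 ≤ ∫ x, (pd 0 ξ₀ x ^ 2 + pd 1 ξ₀ x ^ 2) :=
      integral_nonneg fun x => by positivity
    refine Real.sqrt_le_iff.2 ⟨by positivity, ?_⟩
    rw [mul_pow, Real.sq_sqrt hI0, mul_pow, ← Real.exp_nat_mul]
    calc ∫ x, (pd 0 (φ₂ t) x ^ 2 + pd 1 (φ₂ t) x ^ 2)
        ≤ (⨆ x, |ω t x|) ^ 2 * ∫ x, (pd 0 (φ₁ t) x ^ 2 + pd 1 (φ₁ t) x ^ 2) :=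
          integral_sq_grad_le (hslice hφ₁ t) (hslice hφ₂ t) (hslice hω t) (hc₁ t ht) (hc₂ t ht)
            (fun x => le_ciSup (f := fun x => |ω t x|) ⟨_, forall_mem_range.2 (hCω t)⟩ x)
            (heq2' t ht)
      _ ≤ (⨆ x, |ω t x|) ^ 2 *
          (Real.exp (((2 : ℕ) : ℝ) * (J * T)) * ∫ x, (pd 0 ξ₀ x ^ 2 + pd 1 ξ₀ x ^ 2)) := by
          refine mul_le_mul_of_nonneg_left ((hgr t ht).trans ?_) (by positivity)
          refine mul_le_mul_of_nonneg_right (Real.exp_le_exp.2 ?_) hI0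
          push_cast
          nlinarith [mul_nonneg hJ0 ht.1, mul_nonneg hJ0 hT.le]
      _ = _ := by ring
  rw [← intervalIntegral.integral_const_mul, ← intervalIntegral.integral_mul_const,
    intervalIntegral.integral_of_le hT.le, intervalIntegral.integral_of_le hT.le]
  refine integral_mono_of_nonneg (.of_forall fun t => Real.sqrt_nonneg _) ?_ ?_
  · exact (((intervalIntegrable_iSup_abs hω.continuous hCω 0 T).const_mul _).mul_const _).1
  · filter_upwards [ae_restrict_mem measurableSet_Ioc] with t ht
    exact hpt t (Ioc_subset_Icc_self ht)
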